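/- arXiv:2003.11951 — 15 statements merged into one kernel-verified Lean document; each statement's English description precedes it below -/
import Mathlib

section
/- Let λ ∈ ℝ with 0 < |λ| < 1 and let a ∈ ℝ with a ≥ 0. Define s := (1 + aλ² − a + √((a − aλ² − 1)² + 4a))/2. Then s ≥ 1 and s satisfies the scalar discrete algebraic Riccati equation s = λ²(1 − s/(a + s))·s + 1; moreover s is the unique nonnegative real number satisfying this equation. -/
/-- For a nonzero innovation variance, the scalar Riccati equation is a quadratic equation. -/
lemma scalar_dare_iff_quadratic {L a t : ℝ} (h : a + t ≠ 0) :
    t = L * (1 - t / (a + t)) * t + 1 ↔ t ^ 2 + (a - a * L - 1) * t - a = 0 := by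
  have key : (t - (L * (1 - t / (a + t)) * t + 1)) * (a + t) =
      t ^ 2 + (a - a * L - 1) * t - a := by
    field_simp
    ring
  rw [← key, mul_eq_zero, or_iff_left h, sub_eq_zero]

/-- the closed-form expression is at least 1, satisfies the scalar
discrete algebraic Riccati equation, and is the unique nonnegative solution. -/
theorem scalar_dare_solution (lam a : ℝ) (h1 : 0 < |lam|) (h2 : |lam| < 1) (ha : 0 ≤ a) :
    let s : ℝ := (1 + a * lam ^ 2 - a + Real.sqrt ((a - a * lam ^ 2 - 1) ^ 2 + 4 * a)) / 2
    1 ≤ s ∧ s = lam ^ 2 * (1 - s / (a + s)) * s + 1 ∧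
      ∀ t : ℝ, 0 ≤ t → t = lam ^ 2 * (1 - t / (a + t)) * t + 1 → t = s := by
  intro s
  have hs : s = (1 + a * lam ^ 2 - a +
      Real.sqrt ((a - a * lam ^ 2 - 1) ^ 2 + 4 * a)) / 2 := rfl
  clear_value s
  have hL : 0 ≤ a * lam ^ 2 := by positivity
  have hsq := Real.sq_sqrt (show 0 ≤ (a - a * lam ^ 2 - 1) ^ 2 + 4 * a by positivity)
  have hs1 : 1 ≤ s := by
    have : a - a * lam ^ 2 - 1 + 2 ≤ Real.sqrt ((a - a * lam ^ 2 - 1) ^ 2 + 4 * a) :=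
      Real.le_sqrt_of_sq_le (by linarith)
    linarith
  have hquad : s ^ 2 + (a - a * lam ^ 2 - 1) * s - a = 0 := by
    rw [hs]
    linear_combination hsq / 4
  refine ⟨hs1, (scalar_dare_iff_quadratic (by linarith)).2 hquad, fun t ht h ↦ ?_⟩
  have ht0 : 0 < t := ht.lt_of_ne (by rintro rfl; simp at h)
  have htquad := (scalar_dare_iff_quadratic (by linarith)).1 h
  have hfactor : (t - s) * (t * s + a) = 0 := by
    linear_combination s * htquad - t * hquad
  have hpos : 0 < t * s + a := by positivity
  exact sub_eq_zero.1 ((mul_eq_zero.1 hfactor).resolve_right hpos.ne')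
end

section
/- Let n ≥ 2, let λ₁ ∈ ℝ with 0 < |λ₁| < 1, let γ ∈ ℝ^{1×(n−1)} be a row vector and σ_v ≥ 0, and set a := ‖γ‖₂² + σ_v². Let A = diag(λ₁, 0, …, 0) ∈ ℝ^{n×n}, W = I_n, C = [1 γ] ∈ ℝ^{1×n}, and V = σ_v² (a 1×1 matrix). Define s := (1 + aλ₁² − a + √((a − aλ₁² − 1)² + 4a))/2 and let Σ ∈ ℝ^{n×n} be the identity matrix with its (1,1) entry replaced by s. Then CΣCᵀ + V is positive (hence invertible), Σ is positive semidefinite, and Σ satisfies the discrete algebraic Riccati equation Σ = AΣAᵀ + W − AΣCᵀ(CΣCᵀ + V)⁻¹CΣAᵀ. -/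
open Matrix

/-- The closed-form root of the scalar Riccati equation is at least one and solves it. -/
theorem scalar_riccati_root {a l : ℝ} (ha : 0 ≤ a) :
    let s : ℝ := (1 + a * l ^ 2 - a + Real.sqrt ((a - a * l ^ 2 - 1) ^ 2 + 4 * a)) / 2
    1 ≤ s ∧ s * (s + a) = l ^ 2 * s * a + (s + a) := by
  intro s
  have hsq := Real.sq_sqrt (show 0 ≤ (a - a * l ^ 2 - 1) ^ 2 + 4 * a by positivity)
  have hle : 1 - a * l ^ 2 + a ≤ Real.sqrt ((a - a * l ^ 2 - 1) ^ 2 + 4 * a) :=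
    Real.le_sqrt_of_sq_le (by nlinarith [mul_nonneg ha (sq_nonneg l)])
  refine ⟨by simp only [s]; linarith, ?_⟩
  simp only [s]
  linear_combination hsq / 4

/-- for the system with `A = diag(λ₁,0,…,0)`, `W = I`, a single sensor
`C = [1 γ]` with noise variance `σᵥ²`, the matrix `Σ = diag(s,1,…,1)` (with `s` given by
the closed-form scalar Riccati solution for `a = ‖γ‖₂² + σᵥ²`) is positive semidefinite,
the innovation matrix `CΣCᵀ + V` is positive definite (hence invertible), and `Σ`
satisfies the discrete algebraic Riccati equation. -/
theorem dare_single_sensor_solution (n : ℕ) (hn : 1 ≤ n) (lam1 : ℝ)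
    (h1 : 0 < |lam1|) (h2 : |lam1| < 1) (γ : Fin n → ℝ) (σv : ℝ) (hσ : 0 ≤ σv) :
    let a : ℝ := (∑ i, γ i ^ 2) + σv ^ 2
    let s : ℝ := (1 + a * lam1 ^ 2 - a + Real.sqrt ((a - a * lam1 ^ 2 - 1) ^ 2 + 4 * a)) / 2
    let A : Matrix (Fin (n + 1)) (Fin (n + 1)) ℝ := Matrix.diagonal (Fin.cons lam1 0)
    let W : Matrix (Fin (n + 1)) (Fin (n + 1)) ℝ := 1
    let C : Matrix (Fin 1) (Fin (n + 1)) ℝ := fun _ => Fin.cons 1 γ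
    let V : Matrix (Fin 1) (Fin 1) ℝ := Matrix.diagonal fun _ => σv ^ 2
    let Sig : Matrix (Fin (n + 1)) (Fin (n + 1)) ℝ := Matrix.diagonal (Fin.cons s 1)
    (C * Sig * Cᵀ + V).PosDef ∧ IsUnit (C * Sig * Cᵀ + V) ∧ Sig.PosSemidef ∧
      Sig = A * Sig * Aᵀ + W - A * Sig * Cᵀ * (C * Sig * Cᵀ + V)⁻¹ * (C * Sig * Aᵀ) := by
  intro a s A W C V Sig
  have ha : 0 ≤ a := by positivity
  obtain ⟨hs, hr⟩ : 1 ≤ s ∧ s * (s + a) = lam1 ^ 2 * s * a + (s + a) := scalar_riccati_root ha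
  have hsa : 0 < s + a := by linarith
  have hC0 (i) : C i 0 = 1 := rfl
  have hCsucc (i) (j : Fin n) : C i j.succ = γ j := rfl
  clear_value C s
  have hM : C * Sig * Cᵀ + V = diagonal fun _ => s + a := by
    ext i j
    fin_cases i; fin_cases j
    simp only [Sig, V, a, Matrix.add_apply, Matrix.mul_apply (M := _ * _), Matrix.mul_diagonal,
      transpose_apply, Fin.sum_univ_succ, hC0, hCsucc]
    simp [pow_two]
    ring
  have hpos : (C * Sig * Cᵀ + V).PosDef := by
    rw [hM]
    exact PosDef.diagonal fun _ => hsa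
  have hinv : (C * Sig * Cᵀ + V)⁻¹ = diagonal fun _ => (s + a)⁻¹ := by
    rw [hM]
    refine Matrix.inv_eq_right_inv ?_
    rw [diagonal_mul_diagonal]
    simp [hsa.ne']
  refine ⟨hpos, hpos.isUnit, ?_, ?_⟩
  · refine PosSemidef.diagonal fun i => ?_
    refine Fin.cases ?_ (fun i => ?_) i
    · simp; linarith
    · simp
  · rw [hinv]
    ext i j
    simp only [A, Sig, W, diagonal_transpose, Matrix.add_apply, Matrix.sub_apply,
      Matrix.mul_apply (M := _ * _), Finset.univ_unique, Finset.sum_singleton,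
      Matrix.mul_diagonal, diagonal_mul_diagonal, Matrix.diagonal_mul, transpose_apply]
    refine Fin.cases ?_ (fun i => ?_) i <;> refine Fin.cases ?_ (fun j => ?_) j
    · simp [hC0, diagonal_apply]
      field_simp
      linear_combination hr
    · simp [diagonal_apply, (Fin.succ_ne_zero j).symm]
    · simp [diagonal_apply]
    · simp [diagonal_apply, Matrix.one_apply]
end

section
/- Let λ ∈ ℝ with 0 < |λ| < 1. Define s(a) := (1 + aλ² − a + √((a − aλ² − 1)² + 4a))/2 for a ≥ 0. Then: (i) s is strictly increasing on [0, ∞); (ii) s(a) < 1/(1 − λ²) for all a ≥ 0; and (iii) s(a) → 1/(1 − λ²) as a → ∞. -/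
/-- The nonnegative root of `x ^ 2 - x = a * (1 - c * x)`. -/
noncomputable def riccatiRoot (c a : ℝ) : ℝ :=
  (1 - c * a + Real.sqrt ((c * a - 1) ^ 2 + 4 * a)) / 2

theorem riccatiRoot_eq (c : ℝ) {a : ℝ} (ha : 0 ≤ a) :
    riccatiRoot c a ^ 2 - riccatiRoot c a = a * (1 - c * riccatiRoot c a) := by
  have h := Real.sq_sqrt (show 0 ≤ (c * a - 1) ^ 2 + 4 * a by positivity)
  unfold riccatiRoot
  linear_combination h / 4

theorem one_le_riccatiRoot {c a : ℝ} (hc1 : c < 1) (ha : 0 ≤ a) :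
    1 ≤ riccatiRoot c a := by
  have h : 1 + c * a ≤ Real.sqrt ((c * a - 1) ^ 2 + 4 * a) :=
    Real.le_sqrt_of_sq_le (by nlinarith [mul_nonneg ha (sub_nonneg.2 hc1.le)])
  unfold riccatiRoot
  linarith

theorem riccatiRoot_lt {c a : ℝ} (hc0 : 0 < c) (hc1 : c < 1) (ha : 0 ≤ a) :
    riccatiRoot c a < 1 / c := by
  by_contra! h
  have h_one : 1 < riccatiRoot c a := ((one_lt_div hc0).2 hc1).trans_le h
  rw [div_le_iff₀ hc0] at h
  have heq := riccatiRoot_eq c ha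
  nlinarith [mul_nonneg ha (sub_nonneg.2 h)]

theorem riccatiRoot_strictMonoOn {c : ℝ} (hc0 : 0 < c) (hc1 : c < 1) :
    StrictMonoOn (riccatiRoot c) (Set.Ici 0) := by
  intro a ha b hb hab
  by_contra! h
  have hlt := riccatiRoot_lt hc0 hc1 ha
  rw [lt_div_iff₀ hc0] at hlt
  have h_one := one_le_riccatiRoot hc1 hb
  have hmul : a * (1 - c * riccatiRoot c a) < b * (1 - c * riccatiRoot c a) :=
    mul_lt_mul_of_pos_right hab (by linarith)
  have hmul' : b * (1 - c * riccatiRoot c a) ≤ b * (1 - c * riccatiRoot c b) :=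
    mul_le_mul_of_nonneg_left (by nlinarith) hb
  have ha' := riccatiRoot_eq c ha
  have hb' := riccatiRoot_eq c hb
  nlinarith

theorem riccatiRoot_tendsto {c : ℝ} (hc0 : 0 < c) (hc1 : c < 1) :
    Filter.Tendsto (riccatiRoot c) Filter.atTop (nhds (1 / c)) := by
  have hlim : Filter.Tendsto (fun a : ℝ => 1 / c - 1 / c ^ 3 / a) Filter.atTop
      (nhds (1 / c)) := by
    simpa only [sub_zero, id] using (tendsto_const_nhds (x := 1 / c)).sub
      (Filter.Tendsto.const_div_atTop Filter.tendsto_id (1 / c ^ 3))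
  refine tendsto_of_tendsto_of_tendsto_of_le_of_le' hlim tendsto_const_nhds ?_ ?_
  · filter_upwards [Filter.eventually_gt_atTop 0] with a ha
    have heq := riccatiRoot_eq c ha.le
    have hlt := riccatiRoot_lt hc0 hc1 ha.le
    have h_one := one_le_riccatiRoot hc1 ha.le
    have hsq : riccatiRoot c a ^ 2 ≤ (1 / c) ^ 2 := by gcongr
    have hdiff : 1 / c - riccatiRoot c a =
        (riccatiRoot c a ^ 2 - riccatiRoot c a) / (c * a) := by
      rw [heq]; field_simp
    have hle : (riccatiRoot c a ^ 2 - riccatiRoot c a) / (c * a) ≤ (1 / c) ^ 2 / (c * a) := by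
      gcongr
      linarith
    have hpow : (1 / c) ^ 2 / (c * a) = 1 / c ^ 3 / a := by field_simp
    linarith
  · filter_upwards [Filter.eventually_ge_atTop 0] with a ha
    exact (riccatiRoot_lt hc0 hc1 ha).le

/-- the scalar steady-state MSEE `s(a)` is strictly increasing on `[0,∞)`,
bounded above by `1/(1-λ²)`, and tends to `1/(1-λ²)` as `a → ∞`. -/
theorem scalar_mse_strictMono_and_limit (lam : ℝ) (h1 : 0 < |lam|) (h2 : |lam| < 1) :
    let s : ℝ → ℝ := fun a =>
      (1 + a * lam ^ 2 - a + Real.sqrt ((a - a * lam ^ 2 - 1) ^ 2 + 4 * a)) / 2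
    StrictMonoOn s (Set.Ici 0) ∧
      (∀ a : ℝ, 0 ≤ a → s a < 1 / (1 - lam ^ 2)) ∧
      Filter.Tendsto s Filter.atTop (nhds (1 / (1 - lam ^ 2))) := by
  intro s
  obtain ⟨c, hc⟩ : ∃ c : ℝ, c = 1 - lam ^ 2 := ⟨_, rfl⟩
  have hc0 : 0 < c := by
    have := (sq_lt_one_iff_abs_lt_one lam).2 h2
    linarith
  have hc1 : c < 1 := by
    have : 0 < lam ^ 2 := by rw [← sq_abs]; positivity
    linarith
  have hs : s = fun a => (1 - c * a + Real.sqrt ((c * a - 1) ^ 2 + 4 * a)) / 2 := by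
    funext a
    have e₁ : a - a * lam ^ 2 - 1 = c * a - 1 := by rw [hc]; ring
    have e₂ : 1 + a * lam ^ 2 - a = 1 - c * a := by rw [hc]; ring
    simp only [s, e₁, e₂]
  rw [hs, ← hc]
  exact ⟨riccatiRoot_strictMonoOn hc0 hc1, fun a ha => riccatiRoot_lt hc0 hc1 ha,
    riccatiRoot_tendsto hc0 hc1⟩
end

section
/- Let n ≥ 2, put n′ := n − 1, let λ₁ ∈ ℝ with 0 < |λ₁| < 1, and let ρ ∈ ℝ with ρ ≠ 0. Let A = diag(λ₁, 0, …, 0) ∈ ℝ^{n×n}, W = I_n, C = [𝟙_{n′} ρI_{n′}] ∈ ℝ^{n′×n} (first column all ones, remaining columns ρ times the identity), and V = 0 ∈ ℝ^{n′×n′}. Define s′ := (λ₁²ρ² + n′ − ρ² + √((ρ² − λ₁²ρ² − n′)² + 4n′ρ²))/(2n′) and let Σ ∈ ℝ^{n×n} be the identity matrix with its (1,1) entry replaced by s′. Then CΣCᵀ is invertible, Σ is positive semidefinite, and Σ satisfies the discrete algebraic Riccati equation Σ = AΣAᵀ + W − AΣCᵀ(CΣCᵀ)⁻¹CΣAᵀ.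 -/
open Matrix

/-- The positive root of `n s² + b s - r = 0` given by the quadratic formula. -/
lemma quadratic_root_pos_and_eq {n b r : ℝ} (hn : 0 < n) (hr : 0 < r) :
    let s := (-b + Real.sqrt (b ^ 2 + 4 * n * r)) / (2 * n)
    0 < s ∧ n * s ^ 2 + b * s - r = 0 := by
  intro s
  have hq : Real.sqrt (b ^ 2 + 4 * n * r) ^ 2 = b ^ 2 + 4 * n * r :=
    Real.sq_sqrt (by positivity)
  have hlt : b < Real.sqrt (b ^ 2 + 4 * n * r) := by
    apply Real.lt_sqrt_of_sq_lt
    have : 0 < 4 * n * r := by positivity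
    linarith
  refine ⟨div_pos (by linarith) (by positivity), ?_⟩
  have hs : 2 * n * s = -b + Real.sqrt (b ^ 2 + 4 * n * r) :=
    mul_div_cancel₀ _ (by positivity)
  have : 4 * n * (n * s ^ 2 + b * s - r) = 0 := by
    rw [show Real.sqrt (b ^ 2 + 4 * n * r) = 2 * n * s + b by linarith] at hq
    linear_combination hq
  exact (mul_eq_zero.mp this).resolve_left (by positivity)

/-- A scaled identity plus a nonnegative multiple of the all-ones matrix is positive definite. -/
lemma posDef_smul_one_add_smul_ones {m : Type*} [Fintype m] [DecidableEq m] {r s : ℝ}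
    (hr : 0 < r) (hs : 0 ≤ s) :
    (r • (1 : Matrix m m ℝ) + s • vecMulVec 1 1).PosDef := by
  have hones : (vecMulVec (1 : m → ℝ) 1).PosSemidef := by
    simpa using posSemidef_vecMulVec_self_star (1 : m → ℝ)
  exact (PosDef.one.smul hr).add_posSemidef (hones.smul hs)

/-- If `K` consists of eigenvectors of `M`, then `M⁻¹` acts on `K` by the inverse eigenvalue. -/
lemma nonsing_inv_mul_of_mul_eq_smul {m l : Type*} [Fintype m] [DecidableEq m]
    {M : Matrix m m ℝ} (hM : IsUnit M) {K : Matrix m l ℝ} {d : ℝ} (hd : d ≠ 0)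
    (h : M * K = d • K) : M⁻¹ * K = d⁻¹ • K := by
  have hdet := (isUnit_iff_isUnit_det M).mp hM
  calc M⁻¹ * K = d⁻¹ • (M⁻¹ * (d • K)) := by rw [Matrix.mul_smul, inv_smul_smul₀ hd]
    _ = d⁻¹ • K := by rw [← h, nonsing_inv_mul_cancel_left _ _ hdet]

/-- for the system with `A = diag(λ₁,0,…,0)`, `W = I`, measurement matrix
`C = [𝟙 ρI]` and zero measurement noise, the matrix `Σ = diag(s',1,…,1)` (with `s'` given
by the stated closed form) is positive semidefinite, `CΣCᵀ` is invertible, and `Σ`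
satisfies the discrete algebraic Riccati equation. -/
theorem dare_ones_rhoId_solution (n' : ℕ) (hn' : 1 ≤ n') (lam1 : ℝ)
    (h1 : 0 < |lam1|) (h2 : |lam1| < 1) (ρ : ℝ) (hρ : ρ ≠ 0) :
    let s' : ℝ := (lam1 ^ 2 * ρ ^ 2 + n' - ρ ^ 2 +
      Real.sqrt ((ρ ^ 2 - lam1 ^ 2 * ρ ^ 2 - n') ^ 2 + 4 * n' * ρ ^ 2)) / (2 * n')
    let A : Matrix (Fin (n' + 1)) (Fin (n' + 1)) ℝ := Matrix.diagonal (Fin.cons lam1 0)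
    let W : Matrix (Fin (n' + 1)) (Fin (n' + 1)) ℝ := 1
    let C : Matrix (Fin n') (Fin (n' + 1)) ℝ :=
      fun i => Fin.cons 1 (fun j => if i = j then ρ else 0)
    let Sig : Matrix (Fin (n' + 1)) (Fin (n' + 1)) ℝ := Matrix.diagonal (Fin.cons s' 1)
    IsUnit (C * Sig * Cᵀ) ∧ Sig.PosSemidef ∧
      Sig = A * Sig * Aᵀ + W - A * Sig * Cᵀ * (C * Sig * Cᵀ)⁻¹ * (C * Sig * Aᵀ) := by
  intro s' A W C Sig
  have hn : (0 : ℝ) < n' := by exact_mod_cast hn'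
  have hr : 0 < ρ ^ 2 := by positivity
  obtain ⟨hs, hquad⟩ : 0 < s' ∧
      n' * s' ^ 2 + (ρ ^ 2 - lam1 ^ 2 * ρ ^ 2 - n') * s' - ρ ^ 2 = 0 := by
    have hroot : s' = (-(ρ ^ 2 - lam1 ^ 2 * ρ ^ 2 - n') +
        Real.sqrt ((ρ ^ 2 - lam1 ^ 2 * ρ ^ 2 - n') ^ 2 + 4 * n' * ρ ^ 2)) / (2 * n') := by
      simp only [s']
      ring
    rw [hroot]
    exact quadratic_root_pos_and_eq hn hr
  clear_value s'
  have hd : ρ ^ 2 + n' * s' ≠ 0 := by positivity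
  have hC0 (i : Fin n') : C i 0 = 1 := rfl
  have hCs (i j : Fin n') : C i j.succ = if i = j then ρ else 0 := rfl
  clear_value C
  have hM : C * Sig * Cᵀ = ρ ^ 2 • (1 : Matrix (Fin n') (Fin n') ℝ) + s' • vecMulVec 1 1 := by
    ext i j
    rw [mul_apply, Fin.sum_univ_succ, Matrix.add_apply, Matrix.smul_apply, Matrix.smul_apply,
      vecMulVec_apply]
    by_cases h : i = j
    · subst h
      simp [Sig, hC0, hCs]
      ring
    · simp [Sig, hC0, hCs, h]
  have hK : C * Sig * Aᵀ = (lam1 * s') • vecMulVec 1 (Pi.single 0 1) := by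
    ext i j
    rw [Matrix.smul_apply, vecMulVec_apply]
    refine Fin.cases ?_ (fun j => ?_) j <;> simp [hC0, Sig, A, mul_comm]
  have hL : A * Sig * Cᵀ = (lam1 * s') • vecMulVec (Pi.single 0 1) 1 := by
    ext i j
    rw [Matrix.smul_apply, vecMulVec_apply]
    refine Fin.cases ?_ (fun i => ?_) i <;> simp [hC0, Sig, A]
  have hunit : IsUnit (C * Sig * Cᵀ) := by
    rw [hM]
    exact (posDef_smul_one_add_smul_ones hr hs.le).isUnit
  have hMK : C * Sig * Cᵀ * (C * Sig * Aᵀ) = (ρ ^ 2 + n' * s') • (C * Sig * Aᵀ) := by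
    rw [hM, hK, Matrix.mul_smul, Matrix.add_mul, Matrix.smul_mul, Matrix.smul_mul, Matrix.one_mul,
      vecMulVec_mul_vecMulVec, one_dotProduct_one, Fintype.card_fin, vecMulVec_smul]
    module
  have hLK : A * Sig * Cᵀ * (C * Sig * Aᵀ) =
      diagonal (Pi.single 0 (n' * (lam1 * s') ^ 2)) := by
    rw [hL, hK, Matrix.smul_mul, Matrix.mul_smul, vecMulVec_mul_vecMulVec, one_dotProduct_one,
      Fintype.card_fin, vecMulVec_smul, ← single_eq_single_vecMulVec_single,
      diagonal_single]
    simp only [smul_single, smul_eq_mul]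
    congr 1
    ring
  refine ⟨hunit, ?_, ?_⟩
  · refine PosSemidef.diagonal fun i => ?_
    refine Fin.cases ?_ (fun i => ?_) i <;> simp [hs.le]
  · rw [Matrix.mul_assoc _ _ (C * Sig * Aᵀ), nonsing_inv_mul_of_mul_eq_smul hunit hd hMK,
      Matrix.mul_smul, hLK]
    simp only [Sig, A, W, diagonal_transpose, diagonal_mul_diagonal, ← diagonal_one, diagonal_add,
      ← diagonal_smul, diagonal_sub]
    congr 1
    ext i
    refine Fin.cases ?_ (fun i => ?_) i
    · simp
      field_simp
      linear_combination hquad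
    · simp
end

section
/- Let λ₁ ∈ ℝ with 0 < |λ₁| < 1 and let n′ be a positive integer. Define s′(r) := (λ₁²r + n′ − r + √((r − λ₁²r − n′)² + 4n′r))/(2n′) for r ≥ 0. Then s′ is strictly increasing on [0, ∞) and s′(r) → 1/(1 − λ₁²) as r → ∞. -/
/-- The nonnegative root `s` of `n s² + (a r - n) s - r = 0` satisfies `1 ≤ s < 1 / a`. -/
lemma riccati_root_bounds {a n r s : ℝ} (ha : 0 < a) (ha1 : a < 1) (hn : 0 < n) (hr : 0 ≤ r)
    (hs : s = (n - a * r + Real.sqrt ((a * r - n) ^ 2 + 4 * n * r)) / (2 * n)) :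
    1 ≤ s ∧ a * s < 1 ∧ n * s * (s - 1) = r * (1 - a * s) := by
  have hnr : 0 ≤ n * r := by positivity
  have har : 0 ≤ a * r := by positivity
  have hq0 := Real.sqrt_nonneg ((a * r - n) ^ 2 + 4 * n * r)
  have hq := Real.sq_sqrt (show 0 ≤ (a * r - n) ^ 2 + 4 * n * r by positivity)
  set q := Real.sqrt ((a * r - n) ^ 2 + 4 * n * r)
  have hqs : q = 2 * n * s - n + a * r := by
    rw [hs]; field_simp; ring
  have hroot : n * s * (s - 1) = r * (1 - a * s) := by
    rw [hqs] at hq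
    have : 4 * n * (n * s * (s - 1)) = 4 * n * (r * (1 - a * s)) := by linear_combination hq
    exact mul_left_cancel₀ (by positivity) this
  have hge : n + a * r ≤ q := by
    apply le_of_sq_le_sq _ hq0
    nlinarith [mul_nonneg hnr (sub_pos.2 ha1).le]
  have hlt : a * q < 2 * n + a * (a * r - n) := by
    apply lt_of_pow_lt_pow_left₀ 2
    · nlinarith [mul_nonneg ha.le har, mul_pos hn (sub_pos.2 ha1)]
    · rw [mul_pow, hq]
      nlinarith [mul_pos (mul_pos hn hn) (sub_pos.2 ha1)]
  refine ⟨?_, ?_, hroot⟩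
  · rw [hqs] at hge
    exact le_of_mul_le_mul_left (by linarith) hn
  · rw [hqs] at hlt
    exact lt_of_mul_lt_mul_left (by linarith) hn.le

/-- `s'(r)` is strictly increasing on `[0,∞)` and tends to `1/(1-λ₁²)`
as `r → ∞`. -/
theorem scalar_mse_multisensor_strictMono_and_limit (lam1 : ℝ)
    (h1 : 0 < |lam1|) (h2 : |lam1| < 1) (n' : ℕ) (hn' : 0 < n') :
    let s' : ℝ → ℝ := fun r =>
      (lam1 ^ 2 * r + n' - r + Real.sqrt ((r - lam1 ^ 2 * r - n') ^ 2 + 4 * n' * r)) / (2 * n')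
    StrictMonoOn s' (Set.Ici 0) ∧
      Filter.Tendsto s' Filter.atTop (nhds (1 / (1 - lam1 ^ 2))) := by
  intro s'
  have hn : (0 : ℝ) < n' := by exact_mod_cast hn'
  have hl0 : 0 < lam1 ^ 2 := by have := abs_pos.1 h1; positivity
  have hl1 : lam1 ^ 2 < 1 := (sq_lt_one_iff_abs_lt_one lam1).2 h2
  have ha : 0 < 1 - lam1 ^ 2 := by linarith
  have ha1 : 1 - lam1 ^ 2 < 1 := by linarith
  have key : ∀ r, 0 ≤ r → 1 ≤ s' r ∧ (1 - lam1 ^ 2) * s' r < 1 ∧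
      n' * s' r * (s' r - 1) = r * (1 - (1 - lam1 ^ 2) * s' r) := by
    intro r hr
    refine riccati_root_bounds ha ha1 hn hr ?_
    simp only [s']
    ring_nf
  generalize s' = s at key ⊢
  generalize 1 - lam1 ^ 2 = a at ha key ⊢
  constructor
  · intro x hx y hy hxy
    obtain ⟨_, _, hx3⟩ := key x hx
    obtain ⟨hy1, hy2, hy3⟩ := key y hy
    by_contra! hle
    have hprod : n' * s y * (s y - 1) ≤ n' * s x * (s x - 1) := by
      gcongr
    have hfac : x * (1 - a * s x) ≤ x * (1 - a * s y) :=
      mul_le_mul_of_nonneg_left (by nlinarith) hx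
    have hstrict : x * (1 - a * s y) < y * (1 - a * s y) :=
      mul_lt_mul_of_pos_right hxy (by linarith)
    linarith
  · have hlow : Filter.Tendsto (fun r : ℝ => 1 / a - n' / a ^ 3 / r) Filter.atTop
        (nhds (1 / a)) := by
      simpa using (tendsto_const_nhds (x := 1 / a)).sub
        (Filter.Tendsto.const_div_atTop Filter.tendsto_id (n' / a ^ 3 : ℝ))
    refine tendsto_of_tendsto_of_tendsto_of_le_of_le' hlow tendsto_const_nhds ?_ ?_
    · filter_upwards [Filter.eventually_gt_atTop 0] with r hr
      obtain ⟨hs1, hs2, hs3⟩ := key r hr.le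
      have hub : s r ≤ 1 / a := by rw [le_div_iff₀ ha]; linarith
      have hprod : n' * s r * (s r - 1) ≤ n' * (1 / a) * (1 / a) := by
        gcongr; linarith
      have hgap : 1 / a - s r = n' * s r * (s r - 1) / (a * r) := by
        rw [hs3]; field_simp
      have hbound : n' * s r * (s r - 1) / (a * r) ≤ n' * (1 / a) * (1 / a) / (a * r) := by
        gcongr
      have heq : n' * (1 / a) * (1 / a) / (a * r) = n' / a ^ 3 / r := by field_simp
      linarith
    · filter_upwards [Filter.eventually_ge_atTop 0] with r hr
      rw [le_div_iff₀ ha]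
      linarith [(key r hr).2.1]
end

section
/- Let A = diag(λ₁, …, λ_n) ∈ ℝ^{n×n} with 0 ≤ |λ_i| < 1 for all i, let W ∈ ℝ^{n×n} be diagonal with nonnegative diagonal entries, let C ∈ ℝ^{s×n} be arbitrary, and let V ∈ ℝ^{s×s} be positive definite. Define the Riccati recursion Σ₀ = I_n and Σ_{k+1} = AΣ_kAᵀ + W − AΣ_kCᵀ(CΣ_kCᵀ + V)⁻¹CΣ_kAᵀ for k ≥ 0. If the sequence (Σ_k) converges (entrywise) to a matrix Σ, then for every i ∈ {1, …, n}: W_{ii} ≤ Σ_{ii} ≤ W_{ii}/(1 − λ_i²). -/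
open Matrix

namespace Riccati

variable {n s : Type*} [Fintype n] [Fintype s]

/-- The innovation covariance `C S Cᵀ + V` is positive definite. -/
lemma posDef_innovation {C : Matrix s n ℝ} {V : Matrix s s ℝ} (hV : V.PosDef)
    {S : Matrix n n ℝ} (hS : S.PosSemidef) : (C * S * Cᵀ + V).PosDef := by
  have h := hS.mul_mul_conjTranspose_same C
  rw [conjTranspose_eq_transpose_of_trivial] at h
  exact PosDef.posSemidef_add h hV

variable [DecidableEq s]

/-- The covariance reduction of a measurement update is positive semidefinite. -/
lemma posSemidef_reduction {C : Matrix s n ℝ} {V : Matrix s s ℝ} (hV : V.PosDef)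
    {S : Matrix n n ℝ} (hS : S.PosSemidef) :
    (S * Cᵀ * (C * S * Cᵀ + V)⁻¹ * (C * S)).PosSemidef := by
  have h := (posDef_innovation (C := C) hV hS).inv.posSemidef.mul_mul_conjTranspose_same (S * Cᵀ)
  have hST : Sᵀ = S := hS.isHermitian
  simpa [conjTranspose_eq_transpose_of_trivial, transpose_mul, hST] using h

/-- A Riccati step is a measurement update followed by a time update. -/
lemma step_eq (A W : Matrix n n ℝ) (C : Matrix s n ℝ) (V : Matrix s s ℝ) (S : Matrix n n ℝ) :
    A * S * Aᵀ + W - A * S * Cᵀ * (C * S * Cᵀ + V)⁻¹ * (C * S * Aᵀ) =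
      A * (S - S * Cᵀ * (C * S * Cᵀ + V)⁻¹ * (C * S)) * Aᵀ + W := by
  simp only [Matrix.mul_sub, Matrix.sub_mul, Matrix.mul_assoc]
  abel

variable [DecidableEq n]

/-- The Joseph form of the a posteriori covariance. -/
lemma joseph_form {C : Matrix s n ℝ} {V : Matrix s s ℝ} {S : Matrix n n ℝ}
    (hST : Sᵀ = S) (hVT : Vᵀ = V) (hM : IsUnit (C * S * Cᵀ + V)) :
    S - S * Cᵀ * (C * S * Cᵀ + V)⁻¹ * (C * S) =
      (1 - S * Cᵀ * (C * S * Cᵀ + V)⁻¹ * C) * S * (1 - S * Cᵀ * (C * S * Cᵀ + V)⁻¹ * C)ᵀ +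
        S * Cᵀ * (C * S * Cᵀ + V)⁻¹ * V * (S * Cᵀ * (C * S * Cᵀ + V)⁻¹)ᵀ := by
  set M := C * S * Cᵀ + V with hMdef
  have hMT : Mᵀ = M := by
    simp [hMdef, transpose_mul, hST, hVT, Matrix.mul_assoc]
  set K := S * Cᵀ * M⁻¹ with hK
  have hKM : K * M = S * Cᵀ := by
    rw [hK, Matrix.mul_assoc, nonsing_inv_mul M ((isUnit_iff_isUnit_det M).1 hM), Matrix.mul_one]
  have hKMK : K * (C * S * Cᵀ) * Kᵀ + K * V * Kᵀ = S * Cᵀ * Kᵀ := by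
    rw [← Matrix.add_mul, ← Matrix.mul_add, ← hMdef, hKM]
  rw [transpose_sub, transpose_one, transpose_mul]
  have hexp : (1 - K * C) * S * (1 - Cᵀ * Kᵀ) + K * V * Kᵀ =
      S - K * (C * S) - S * Cᵀ * Kᵀ + (K * (C * S * Cᵀ) * Kᵀ + K * V * Kᵀ) := by
    simp only [Matrix.mul_sub, Matrix.sub_mul, Matrix.mul_one, Matrix.one_mul, Matrix.mul_assoc]
    abel
  rw [hexp, hKMK]
  abel

/-- The a posteriori covariance is positive semidefinite. -/
lemma posSemidef_update {C : Matrix s n ℝ} {V : Matrix s s ℝ} (hV : V.PosDef)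
    {S : Matrix n n ℝ} (hS : S.PosSemidef) :
    (S - S * Cᵀ * (C * S * Cᵀ + V)⁻¹ * (C * S)).PosSemidef := by
  have hST : Sᵀ = S := hS.isHermitian
  have hVT : Vᵀ = V := hV.isHermitian
  rw [joseph_form hST hVT (posDef_innovation hV hS).isUnit]
  exact (hS.mul_mul_conjTranspose_same _).add (hV.posSemidef.mul_mul_conjTranspose_same _)

end Riccati

/-- for the Riccati recursion with stable diagonal `A = diagonal lam`,
diagonal `W = diagonal d` with nonnegative entries, arbitrary `C`, and positive definite
`V`, if the iterates converge entrywise to `L`, then `W_{ii} ≤ L_{ii} ≤ W_{ii}/(1-λᵢ²)`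
for every `i`. -/
theorem riccati_limit_diag_bounds {n s : ℕ} (lam : Fin n → ℝ) (hlam : ∀ i, |lam i| < 1)
    (d : Fin n → ℝ) (hd : ∀ i, 0 ≤ d i)
    (C : Matrix (Fin s) (Fin n) ℝ) (V : Matrix (Fin s) (Fin s) ℝ) (hV : V.PosDef)
    (S : ℕ → Matrix (Fin n) (Fin n) ℝ) (hS0 : S 0 = 1)
    (hrec : ∀ k, S (k + 1) =
      Matrix.diagonal lam * S k * (Matrix.diagonal lam)ᵀ + Matrix.diagonal d -
        Matrix.diagonal lam * S k * Cᵀ * (C * S k * Cᵀ + V)⁻¹ *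
          (C * S k * (Matrix.diagonal lam)ᵀ))
    (L : Matrix (Fin n) (Fin n) ℝ)
    (hconv : ∀ i j, Filter.Tendsto (fun k => S k i j) Filter.atTop (nhds (L i j))) :
    ∀ i, d i ≤ L i i ∧ L i i ≤ d i / (1 - lam i ^ 2) := by
  have hrec' := fun k => (hrec k).trans (Riccati.step_eq _ _ C V (S k))
  have hpos : ∀ k, (S k).PosSemidef := by
    intro k
    induction k with
    | zero => rw [hS0]; exact PosSemidef.one
    | succ k ih =>
      rw [hrec' k]
      exact ((Riccati.posSemidef_update hV ih).mul_mul_conjTranspose_same _).add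
        (PosSemidef.diagonal hd)
  intro i
  have hdiag : ∀ k, S (k + 1) i i = lam i ^ 2 *
      (S k i i - (S k * Cᵀ * (C * S k * Cᵀ + V)⁻¹ * (C * S k)) i i) + d i := by
    intro k
    rw [hrec' k, diagonal_transpose, Matrix.add_apply, mul_diagonal, diagonal_mul,
      diagonal_apply_eq, Matrix.sub_apply]
    ring
  have hshift := (hconv i i).comp (Filter.tendsto_add_atTop_nat 1)
  have hlower : d i ≤ L i i := by
    refine ge_of_tendsto' hshift fun k => ?_
    have h := (Riccati.posSemidef_update (C := C) hV (hpos k)).diag_nonneg (i := i)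
    rw [Matrix.sub_apply] at h
    rw [Function.comp_apply, hdiag]
    exact le_add_of_nonneg_left (mul_nonneg (sq_nonneg _) h)
  have hupper : L i i ≤ lam i ^ 2 * L i i + d i := by
    refine le_of_tendsto_of_tendsto' hshift (((hconv i i).const_mul _).add_const _) fun k => ?_
    have h := (Riccati.posSemidef_reduction (C := C) hV (hpos k)).diag_nonneg (i := i)
    rw [Function.comp_apply, hdiag]
    gcongr
    exact sub_le_self _ h
  have hsq : lam i ^ 2 < 1 := (sq_lt_one_iff_abs_lt_one _).2 (hlam i)
  refine ⟨hlower, ?_⟩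
  rw [le_div_iff₀ (by linarith)]
  linarith
end

section
/- Let A = diag(λ₁, …, λ_n) ∈ ℝ^{n×n} with 0 ≤ |λ_i| < 1 for all i, let W ∈ ℝ^{n×n} be diagonal with nonnegative diagonal entries, let C ∈ ℝ^{s×n}, and let V ∈ ℝ^{s×s} be positive definite. Define the Riccati recursion Σ₀ = I_n and Σ_{k+1} = AΣ_kAᵀ + W − AΣ_kCᵀ(CΣ_kCᵀ + V)⁻¹CΣ_kAᵀ. Suppose the i-th column of C is the zero vector and the sequence (Σ_k) converges (entrywise) to a matrix Σ. Then Σ_{ii} = W_{ii}/(1 − λ_i²). -/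
open Matrix

/-- If the `i`-th column of `C` is zero and the `i`-th column of `P` is zero off the diagonal,
then the `i`-th column of `C * P` is zero. -/
theorem mul_apply_eq_zero_of_col {m n : Type*} [Fintype n] (C : Matrix m n ℝ)
    (P : Matrix n n ℝ) (i : n) (hC : ∀ r, C r i = 0) (hP : ∀ j, j ≠ i → P j i = 0) (r : m) :
    (C * P) r i = 0 := by
  rw [Matrix.mul_apply]
  refine Finset.sum_eq_zero fun j _ => ?_
  by_cases hj : j = i
  · rw [hj, hC, zero_mul]
  · rw [hP j hj, mul_zero]

/-- If the `i`-th column of `C` is zero and the `i`-th row of `P` is zero off the diagonal,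
then the `i`-th row of `P * Cᵀ` is zero. -/
theorem mul_transpose_apply_eq_zero_of_row {m n : Type*} [Fintype n] (C : Matrix m n ℝ)
    (P : Matrix n n ℝ) (i : n) (hC : ∀ r, C r i = 0) (hP : ∀ j, j ≠ i → P i j = 0) (r : m) :
    (P * Cᵀ) i r = 0 := by
  have h := mul_apply_eq_zero_of_col C Pᵀ i hC hP r
  rwa [← Matrix.transpose_apply (C * Pᵀ), Matrix.transpose_mul, Matrix.transpose_transpose] at h

/-- The Riccati correction term vanishes on the `i`-th row when `P * Cᵀ` does. -/
theorem riccati_correction_row_eq_zero {m n : Type*} [Fintype m] [Fintype n] [DecidableEq n]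
    (lam : n → ℝ) (C : Matrix m n ℝ) (P : Matrix n n ℝ) (M : Matrix m m ℝ) (N : Matrix m n ℝ)
    (i : n) (h : ∀ r, (P * Cᵀ) i r = 0) (j : n) :
    (Matrix.diagonal lam * P * Cᵀ * M * N) i j = 0 := by
  simp only [Matrix.mul_assoc (Matrix.diagonal lam), Matrix.diagonal_mul]
  rw [Matrix.mul_assoc, Matrix.mul_apply]
  simp [h]

/-- The Riccati correction term vanishes on the `i`-th column when `C * P` does. -/
theorem riccati_correction_col_eq_zero {m n : Type*} [Fintype m] [Fintype n] [DecidableEq n]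
    (lam : n → ℝ) (C : Matrix m n ℝ) (P : Matrix n n ℝ) (M : Matrix n m ℝ)
    (i : n) (h : ∀ r, (C * P) r i = 0) (j : n) :
    (M * (C * P * (Matrix.diagonal lam)ᵀ)) j i = 0 := by
  rw [Matrix.mul_apply]
  simp [Matrix.diagonal_transpose, Matrix.mul_diagonal, h]

/-- for the Riccati recursion with stable diagonal `A`, diagonal
nonnegative `W`, and positive definite `V`, if the `i`-th column of `C` is zero and
the iterates converge entrywise to `L`, then `L_{ii} = W_{ii}/(1-λᵢ²)`. -/
theorem riccati_limit_zero_column {n s : ℕ} (lam : Fin n → ℝ) (hlam : ∀ i, |lam i| < 1)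
    (d : Fin n → ℝ) (hd : ∀ i, 0 ≤ d i)
    (C : Matrix (Fin s) (Fin n) ℝ) (V : Matrix (Fin s) (Fin s) ℝ) (hV : V.PosDef)
    (S : ℕ → Matrix (Fin n) (Fin n) ℝ) (hS0 : S 0 = 1)
    (hrec : ∀ k, S (k + 1) =
      Matrix.diagonal lam * S k * (Matrix.diagonal lam)ᵀ + Matrix.diagonal d -
        Matrix.diagonal lam * S k * Cᵀ * (C * S k * Cᵀ + V)⁻¹ *
          (C * S k * (Matrix.diagonal lam)ᵀ))
    (i : Fin n) (hcol : ∀ r, C r i = 0)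
    (L : Matrix (Fin n) (Fin n) ℝ)
    (hconv : ∀ i j, Filter.Tendsto (fun k => S k i j) Filter.atTop (nhds (L i j))) :
    L i i = d i / (1 - lam i ^ 2) := by
  have hoff : ∀ k, (∀ j, j ≠ i → S k j i = 0) ∧ (∀ j, j ≠ i → S k i j = 0) := by
    intro k
    induction k with
    | zero =>
      rw [hS0]
      exact ⟨fun j hj => Matrix.one_apply_ne hj, fun j hj => Matrix.one_apply_ne hj.symm⟩
    | succ k ih =>
      obtain ⟨hc, hr⟩ := ih
      refine ⟨fun j hj => ?_, fun j hj => ?_⟩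
      · rw [hrec, Matrix.sub_apply, riccati_correction_col_eq_zero lam C (S k) _ i
          (mul_apply_eq_zero_of_col C (S k) i hcol hc) j]
        simp [Matrix.diagonal_transpose, Matrix.mul_diagonal, Matrix.diagonal_mul, hc j hj,
          Matrix.diagonal_apply_ne _ hj]
      · rw [hrec, Matrix.sub_apply, riccati_correction_row_eq_zero lam C (S k) _ _ i
          (mul_transpose_apply_eq_zero_of_row C (S k) i hcol hr) j]
        simp [Matrix.diagonal_transpose, Matrix.mul_diagonal, Matrix.diagonal_mul, hr j hj,
          Matrix.diagonal_apply_ne _ hj.symm]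
  have hdiag : ∀ k, S (k + 1) i i = lam i * S k i i * lam i + d i := by
    intro k
    rw [hrec, Matrix.sub_apply, riccati_correction_row_eq_zero lam C (S k) _ _ i
      (mul_transpose_apply_eq_zero_of_row C (S k) i hcol (hoff k).2) i]
    simp [Matrix.diagonal_transpose, Matrix.mul_diagonal, Matrix.diagonal_mul]
  have hshift := (hconv i i).comp (Filter.tendsto_add_atTop_nat 1)
  have hstep := (((hconv i i).const_mul (lam i)).mul_const (lam i)).add_const (d i)
  have hfix : L i i = lam i * L i i * lam i + d i :=
    tendsto_nhds_unique hshift (hstep.congr fun k => (hdiag k).symm)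
  have hlt : lam i ^ 2 < 1 := (sq_lt_one_iff_abs_lt_one _).2 (hlam i)
  rw [eq_div_iff (by linarith)]
  linarith
end

section
/- Let A = diag(λ₁, …, λ_n) ∈ ℝ^{n×n} with 0 ≤ |λ_i| < 1 for all i, let W ∈ ℝ^{n×n} be diagonal with nonnegative diagonal entries, let C ∈ ℝ^{s×n}, and take V = 0 ∈ ℝ^{s×s}. Define the Riccati recursion Σ₀ = I_n and Σ_{k+1} = AΣ_kAᵀ + W − AΣ_kCᵀ(CΣ_kCᵀ)⁻¹CΣ_kAᵀ, and assume CΣ_kCᵀ is invertible for every k. Suppose the standard basis row vector e_i lies in the row space of C, and the sequence (Σ_k) converges (entrywise) to a matrix Σ with CΣCᵀ invertible. Then Σ_{ii} = W_{ii}, and moreover the a posteriori covariance Σ* := Σ − ΣCᵀ(CΣCᵀ)⁻¹CΣ satisfies Σ*_{ii} = 0. -/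
open Matrix

/-- If `e i` is in the row space of `C` and the innovation matrix `C * M * Cᵀ` is invertible, then
exact measurement leaves no posterior variance in coordinate `i`. -/
theorem posterior_apply_self_eq_zero {R m n : Type*} [CommRing R] [Fintype m] [DecidableEq m]
    [Fintype n] [DecidableEq n] (C : Matrix m n R) (M : Matrix n n R)
    (h : IsUnit (C * M * Cᵀ)) (i : n) (y : m → R) (hy : Matrix.vecMul y C = Pi.single i 1) :
    (M - M * Cᵀ * (C * M * Cᵀ)⁻¹ * (C * M)) i i = 0 := by
  set P := M - M * Cᵀ * (C * M * Cᵀ)⁻¹ * (C * M) with hP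
  have hCP : C * P = 0 := by
    have hmul : C * M * Cᵀ * (C * M * Cᵀ)⁻¹ = 1 :=
      Matrix.mul_nonsing_inv _ ((Matrix.isUnit_iff_isUnit_det _).mp h)
    calc C * P = C * M - C * M * Cᵀ * (C * M * Cᵀ)⁻¹ * (C * M) := by
          simp only [hP, Matrix.mul_sub, Matrix.mul_assoc]
      _ = 0 := by rw [hmul, Matrix.one_mul, sub_self]
  have hrow : Matrix.vecMul (Pi.single i 1) P = 0 := by
    rw [← hy, Matrix.vecMul_vecMul, hCP, Matrix.vecMul_zero]
  simpa using congrFun hrow i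

/-- for the Riccati recursion with stable diagonal `A`, diagonal
nonnegative `W`, `V = 0`, and invertible innovation matrices, if the standard basis row
vector `eᵢ` lies in the row space of `C` and the iterates converge entrywise to `L`
(with `C L Cᵀ` invertible), then `L_{ii} = W_{ii}` and the a posteriori covariance
`L - L Cᵀ (C L Cᵀ)⁻¹ C L` has `(i,i)` entry `0`. -/
theorem riccati_limit_exact_measurement {n s : ℕ} (lam : Fin n → ℝ)
    (hlam : ∀ i, |lam i| < 1)
    (d : Fin n → ℝ) (hd : ∀ i, 0 ≤ d i)
    (C : Matrix (Fin s) (Fin n) ℝ)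
    (S : ℕ → Matrix (Fin n) (Fin n) ℝ) (hS0 : S 0 = 1)
    (hrec : ∀ k, S (k + 1) =
      Matrix.diagonal lam * S k * (Matrix.diagonal lam)ᵀ + Matrix.diagonal d -
        Matrix.diagonal lam * S k * Cᵀ * (C * S k * Cᵀ)⁻¹ *
          (C * S k * (Matrix.diagonal lam)ᵀ))
    (hinv : ∀ k, IsUnit (C * S k * Cᵀ))
    (i : Fin n) (y : Fin s → ℝ) (hy : Matrix.vecMul y C = Pi.single i 1)
    (L : Matrix (Fin n) (Fin n) ℝ)
    (hconv : ∀ i j, Filter.Tendsto (fun k => S k i j) Filter.atTop (nhds (L i j)))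
    (hLinv : IsUnit (C * L * Cᵀ)) :
    L i i = d i ∧ (L - L * Cᵀ * (C * L * Cᵀ)⁻¹ * (C * L)) i i = 0 := by
  refine ⟨?_, posterior_apply_self_eq_zero C L hLinv i y hy⟩
  have hstep (k : ℕ) : S (k + 1) i i = d i := by
    have hfactor : S (k + 1) = Matrix.diagonal lam *
        (S k - S k * Cᵀ * (C * S k * Cᵀ)⁻¹ * (C * S k)) * Matrix.diagonal lam +
          Matrix.diagonal d := by
      rw [hrec k, Matrix.diagonal_transpose]
      simp only [Matrix.mul_sub, Matrix.sub_mul, Matrix.mul_assoc]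
      abel
    rw [hfactor, Matrix.add_apply, Matrix.mul_diagonal, Matrix.diagonal_mul,
      posterior_apply_self_eq_zero C (S k) (hinv k) i y hy]
    simp
  refine tendsto_nhds_unique ((hconv i i).comp (Filter.tendsto_add_atTop_nat 1)) ?_
  simp only [Function.comp_def, hstep, tendsto_const_nhds]
end

section
/- Let l, n, κ be positive integers with κ ≥ 1, and let M ∈ ℝ^{l×n} be a matrix of rank r that has at least κ zero columns. Then there exists an orthogonal matrix N ∈ ℝ^{n×n} such that M·N = [0_{l×(n−r)} G̃], where G̃ ∈ ℝ^{l×r} has full column rank r, and such that the row vector 𝟙_nᵀ·N = [γ β] (with γ ∈ ℝ^{1×(n−r)} and β ∈ ℝ^{1×r}) has at least κ entries of γ equal to 1. -/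
open Matrix

/-- An orthonormal family of vectors in a subspace `K` extends to an orthonormal basis of the
whole space whose first `finrank K` vectors lie in `K`, the given family coming first. -/
theorem exists_orthonormalBasis_adapted {E : Type*} [NormedAddCommGroup E]
    [InnerProductSpace ℝ E] [FiniteDimensional ℝ E] {n k c : ℕ} (hn : Module.finrank ℝ E = n)
    (K : Submodule ℝ E) (hk : Module.finrank ℝ K = k)
    (v : Fin c → K) (hv : Orthonormal ℝ v) :
    c ≤ k ∧ ∃ b : OrthonormalBasis (Fin n) ℝ E,
      (∀ i : Fin n, (i : ℕ) < k → b i ∈ K) ∧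
      ∀ (i : Fin c) (j : Fin n), (j : ℕ) = i → b j = v i := by
  have hck : c ≤ k := by
    simpa [hk] using hv.linearIndependent.fintype_card_le_finrank
  refine ⟨hck, ?_⟩
  obtain ⟨bK, hbK⟩ := Orthonormal.exists_orthonormalBasis_extension_of_card_eq (𝕜 := ℝ) (E := K)
    (ι := Fin k) (by simpa using hk) (v := fun i => if h : (i : ℕ) < c then v ⟨i, h⟩ else 0)
    (s := {i | (i : ℕ) < c}) (by
      have := hv.comp (fun i : {i : Fin k | (i : ℕ) < c} => (⟨i.1, i.2⟩ : Fin c))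
        (fun a b h => by ext; simpa using h)
      refine (congrArg (Orthonormal ℝ) (funext fun i => ?_)).mpr this
      have hi : (i.1 : ℕ) < c := i.2
      simp [hi])
  obtain ⟨b, hb⟩ := Orthonormal.exists_orthonormalBasis_extension_of_card_eq (𝕜 := ℝ) (E := E)
    (ι := Fin n) (by simpa using hn)
    (v := fun i => if h : (i : ℕ) < k then (bK ⟨i, h⟩ : E) else 0)
    (s := {i | (i : ℕ) < k}) (by
      have := (bK.orthonormal.comp_linearIsometry K.subtypeₗᵢ).comp
        (fun i : {i : Fin n | (i : ℕ) < k} => (⟨i.1, i.2⟩ : Fin k))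
        (fun a b h => by ext; simpa using h)
      refine (congrArg (Orthonormal ℝ) (funext fun i => ?_)).mpr this
      have hi : (i.1 : ℕ) < k := i.2
      simp [hi])
  refine ⟨b, fun i hi => ?_, fun i j hij => ?_⟩
  · simp [hb i hi, hi]
  · have hjc : (j : ℕ) < c := hij ▸ i.2
    have hjk := hjc.trans_le hck
    have h := hbK ⟨j, hjk⟩ hjc
    rw [hb j hjk, dif_pos hjk, h]
    simp [hij]

/-- If all but `M.rank` columns of `M` vanish, the remaining columns are linearly independent. -/
theorem linearIndependent_cols_of_card_le_rank {m ι R : Type*} [Field R] [Finite m] [Fintype ι]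
    (M : Matrix m ι R) (p : ι → Prop) [DecidablePred p]
    (hzero : ∀ j, ¬ p j → Mᵀ j = 0) (hcard : Fintype.card {j // p j} ≤ M.rank) :
    LinearIndependent R (fun j : {j // p j} => Mᵀ j.val) := by
  have := Fintype.ofFinite m
  rw [linearIndependent_iff_card_le_finrank_span]
  refine hcard.trans ?_
  rw [Matrix.rank_eq_finrank_span_cols]
  refine Submodule.finrank_mono (Submodule.span_le.2 ?_)
  rintro _ ⟨j, rfl⟩
  by_cases hj : p j
  · exact Submodule.subset_span ⟨⟨j, hj⟩, rfl⟩
  · have : M.col j = 0 := hzero j hj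
    rw [this]
    exact Submodule.zero_mem _

/-- if `M ∈ ℝ^{l×n}` has rank `r` and at least `κ ≥ 1` zero columns, then
there is an orthogonal `N` such that `M·N = [0 G̃]` with `G̃` (the last `r` columns) of
full column rank, and the row vector `𝟙ᵀN` has at least `κ` of its first `n - r`
entries equal to `1`. -/
theorem orthogonal_normal_form_of_zero_columns (l n κ r : ℕ) (hl : 0 < l) (hn : 0 < n)
    (hκ : 1 ≤ κ) (M : Matrix (Fin l) (Fin n) ℝ) (hr : M.rank = r)
    (J : Finset (Fin n)) (hJcard : κ ≤ J.card) (hJzero : ∀ j ∈ J, ∀ i, M i j = 0) :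
    ∃ N : Matrix (Fin n) (Fin n) ℝ, Nᵀ * N = 1 ∧
      (∀ i, ∀ j : Fin n, (j : ℕ) < n - r → (M * N) i j = 0) ∧
      LinearIndependent ℝ (fun j : {j : Fin n // n - r ≤ (j : ℕ)} => (M * N)ᵀ j.val) ∧
      κ ≤ (Finset.univ.filter fun j : Fin n =>
        (j : ℕ) < n - r ∧ (∑ i, N i j) = 1).card := by
  have hrn : r ≤ n := hr ▸ M.rank_le_width
  let f : EuclideanSpace ℝ (Fin n) →ₗ[ℝ] (Fin l → ℝ) :=
    M.mulVecLin ∘ₗ (WithLp.linearEquiv 2 ℝ (Fin n → ℝ)).toLinearMap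
  have hker : Module.finrank ℝ f.ker = n - r := by
    have h := f.finrank_range_add_finrank_ker
    have h2 : f.range = M.mulVecLin.range :=
      LinearMap.range_comp_of_range_eq_top _ (LinearEquiv.range _)
    rw [h2, finrank_euclideanSpace_fin] at h
    change M.rank + _ = n at h
    omega
  let σ := J.orderEmbOfFin rfl
  let v : Fin J.card → f.ker := fun i => ⟨EuclideanSpace.single (σ i) 1, by
    have hz := hJzero (σ i) (J.orderEmbOfFin_mem rfl i)
    ext a
    simp [f, hz a]⟩
  have hv : Orthonormal ℝ v := by
    rw [← f.ker.subtypeₗᵢ.orthonormal_comp_iff]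
    exact (EuclideanSpace.orthonormal_single (𝕜 := ℝ) (ι := Fin n)).comp σ σ.injective
  obtain ⟨hck, b, hbK, hbv⟩ := exists_orthonormalBasis_adapted finrank_euclideanSpace_fin f.ker
    hker v hv
  let N : Matrix (Fin n) (Fin n) ℝ := Matrix.of fun i j => b j i
  have hN : Nᵀ * N = 1 := by
    ext i j
    have h := orthonormal_iff_ite.1 b.orthonormal j i
    simp only [PiLp.inner_apply, RCLike.inner_apply, conj_trivial] at h
    simp [Matrix.mul_apply, N, h, Matrix.one_apply, eq_comm]
  have hMN : ∀ i, ∀ j : Fin n, (j : ℕ) < n - r → (M * N) i j = 0 := fun i j hj =>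
    congrFun (LinearMap.mem_ker.1 (hbK j hj)) i
  refine ⟨N, hN, hMN, ?_, ?_⟩
  · refine linearIndependent_cols_of_card_le_rank (M * N) _ (fun j hj => ?_) ?_
    · ext i
      exact hMN i j (not_le.1 hj)
    · rw [Matrix.rank_mul_eq_left_of_isUnit_det N M
        ((Matrix.isUnit_iff_isUnit_det N).1 (IsUnit.of_mul_eq_one_right _ hN)), hr]
      have h := Fintype.card_subtype_compl (fun j : Fin n => (j : ℕ) < n - r)
      simp only [not_lt, Fintype.card_fin, Fintype.card_subtype, Fin.card_filter_val_lt] at h ⊢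
      omega
  · refine hJcard.trans ?_
    let e : Fin J.card ↪ Fin n := Fin.castLEEmb (hck.trans (Nat.sub_le n r))
    have hsub : Finset.univ.map e ⊆ Finset.univ.filter fun j : Fin n =>
        (j : ℕ) < n - r ∧ (∑ i, N i j) = 1 := by
      intro j hj
      obtain ⟨i, -, rfl⟩ := Finset.mem_map.1 hj
      refine Finset.mem_filter.2 ⟨Finset.mem_univ _, i.2.trans_le hck, ?_⟩
      simp [N, hbv i (e i) rfl, v]
    simpa using Finset.card_le_card hsub
end

section
/- Let Z be an integer with Z ≥ 2, let λ := (Z − 1/2)/Z, and let ε ∈ ℝ satisfy ε² > 4Z²(Z − 1). Then (1 + ε²λ² − ε² + √((ε² − ε²λ² − 1)² + 4ε²))/2 > Z. -/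
/-- with `λ = (Z - 1/2)/Z` and `ε² > 4Z²(Z-1)`, the scalar steady-state
MSEE with noise variance `ε²` exceeds `Z`. -/
theorem scalar_mse_gt_Z (Z : ℤ) (hZ : 2 ≤ Z) (ε : ℝ)
    (hε : ε ^ 2 > 4 * (Z : ℝ) ^ 2 * ((Z : ℝ) - 1)) :
    ((1 : ℝ) + ε ^ 2 * (((Z : ℝ) - 1 / 2) / (Z : ℝ)) ^ 2 - ε ^ 2 +
        Real.sqrt ((ε ^ 2 - ε ^ 2 * (((Z : ℝ) - 1 / 2) / (Z : ℝ)) ^ 2 - 1) ^ 2 +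
          4 * ε ^ 2)) / 2 > (Z : ℝ) := by
  have hz : (0 : ℝ) < Z := by exact_mod_cast (by omega : 0 < Z)
  have key : (2 * (Z : ℝ) - 1 + ε ^ 2 - ε ^ 2 * (((Z : ℝ) - 1 / 2) / (Z : ℝ)) ^ 2) ^ 2 <
      (ε ^ 2 - ε ^ 2 * (((Z : ℝ) - 1 / 2) / (Z : ℝ)) ^ 2 - 1) ^ 2 + 4 * ε ^ 2 := by
    have gap : (ε ^ 2 - ε ^ 2 * (((Z : ℝ) - 1 / 2) / (Z : ℝ)) ^ 2 - 1) ^ 2 + 4 * ε ^ 2 -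
        (2 * (Z : ℝ) - 1 + ε ^ 2 - ε ^ 2 * (((Z : ℝ) - 1 / 2) / (Z : ℝ)) ^ 2) ^ 2 =
        (ε ^ 2 - 4 * (Z : ℝ) ^ 2 * ((Z : ℝ) - 1)) / Z := by
      field_simp
      ring
    have pos : 0 < (ε ^ 2 - 4 * (Z : ℝ) ^ 2 * ((Z : ℝ) - 1)) / Z :=
      div_pos (sub_pos.mpr hε) hz
    linarith
  linarith [Real.lt_sqrt_of_sq_lt key]
end

section
/- Let Z and m be integers with Z ≥ 2 and m ≥ 1, let λ := (Z − 1/2)/Z, and let ρ ∈ ℝ satisfy ρ² > 4Z²m(Z − 1). Then (λ²ρ² + m − ρ² + √((ρ² − λ²ρ² − m)² + 4mρ²))/(2m) > Z. -/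
/-- with `λ = (Z - 1/2)/Z` and `ρ² > 4Z²m(Z-1)`, the first-state
steady-state MSEE with `m` sensors exceeds `Z`. -/
theorem multisensor_mse_gt_Z (Z m : ℤ) (hZ : 2 ≤ Z) (hm : 1 ≤ m) (ρ : ℝ)
    (hρ : ρ ^ 2 > 4 * (Z : ℝ) ^ 2 * (m : ℝ) * ((Z : ℝ) - 1)) :
    ((((Z : ℝ) - 1 / 2) / (Z : ℝ)) ^ 2 * ρ ^ 2 + (m : ℝ) - ρ ^ 2 +
        Real.sqrt ((ρ ^ 2 - (((Z : ℝ) - 1 / 2) / (Z : ℝ)) ^ 2 * ρ ^ 2 - (m : ℝ)) ^ 2 +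
          4 * (m : ℝ) * ρ ^ 2)) / (2 * (m : ℝ)) > (Z : ℝ) := by
  have hZ0 : (0 : ℝ) < Z := by exact_mod_cast (by lia : 0 < Z)
  have hm0 : (0 : ℝ) < m := by exact_mod_cast (by lia : 0 < m)
  set d : ℝ := ρ ^ 2 - (((Z : ℝ) - 1 / 2) / (Z : ℝ)) ^ 2 * ρ ^ 2 - (m : ℝ) with hd
  have hZd : (Z : ℝ) * d = ρ ^ 2 - ρ ^ 2 / (4 * Z) - m * Z := by
    rw [hd]
    field_simp
    ring
  have hdiv : (m : ℝ) * Z ^ 2 - m * Z < ρ ^ 2 / (4 * Z) := by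
    rw [lt_div_iff₀ (by positivity)]
    linarith
  have hsqrt : 2 * (m : ℝ) * Z + d < √(d ^ 2 + 4 * m * ρ ^ 2) := by
    apply Real.lt_sqrt_of_sq_lt
    have h : (m : ℝ) * (m * Z ^ 2 + Z * d) < m * ρ ^ 2 :=
      mul_lt_mul_of_pos_left (by linarith) hm0
    linarith
  rw [gt_iff_lt, lt_div_iff₀ (by positivity)]
  linarith
end

section
/- Let λ₁ ∈ ℝ with 0 < λ₁ < 1 and h > 0. Let A = diag(λ₁, 0, 0) ∈ ℝ^{3×3}, W = I₃, C = [[1, 0, h], [0, 1, 1]] ∈ ℝ^{2×3}, and V = 0 ∈ ℝ^{2×2}. Define s := (1 + (h²/2)λ₁² − h²/2 + √((h²/2 − (h²/2)λ₁² − 1)² + 4·(h²/2)))/2 and let Σ ∈ ℝ^{3×3} be the identity matrix with its (1,1) entry replaced by s. Then CΣCᵀ is invertible and Σ satisfies the discrete algebraic Riccati equation Σ = AΣAᵀ + W − AΣCᵀ(CΣCᵀ)⁻¹CΣAᵀ; in particular trace(Σ) = s + 2. -/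
open Matrix

/-- The larger root of `x ^ 2 + b * x - q` is a positive root when `q > 0`. -/
lemma larger_root_pos_and_eq_zero {b q : ℝ} (hq : 0 < q) :
    0 < (-b + Real.sqrt (b ^ 2 + 4 * q)) / 2 ∧
      ((-b + Real.sqrt (b ^ 2 + 4 * q)) / 2) ^ 2 +
        b * ((-b + Real.sqrt (b ^ 2 + 4 * q)) / 2) - q = 0 := by
  have hlt : b < Real.sqrt (b ^ 2 + 4 * q) := Real.lt_sqrt_of_sq_lt (by linarith)
  have hsq : Real.sqrt (b ^ 2 + 4 * q) ^ 2 = b ^ 2 + 4 * q := Real.sq_sqrt (by positivity)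
  exact ⟨by linarith, by linear_combination hsq / 4⟩

/-- greedy selection (sensors 2 and 3) in the three-state example:
`Σ = diag(s,1,1)` solves the DARE for `A = diag(λ₁,0,0)`, `W = I₃`,
`C = [[1,0,h],[0,1,1]]`, `V = 0`, and `trace(Σ) = s + 2`. -/
theorem dare_greedy_selection_example (lam1 h : ℝ) (h1 : 0 < lam1) (h2 : lam1 < 1)
    (hh : 0 < h) :
    let A : Matrix (Fin 3) (Fin 3) ℝ := Matrix.diagonal ![lam1, 0, 0]
    let W : Matrix (Fin 3) (Fin 3) ℝ := 1
    let C : Matrix (Fin 2) (Fin 3) ℝ := !![1, 0, h; 0, 1, 1]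
    let s : ℝ := (1 + (h ^ 2 / 2) * lam1 ^ 2 - h ^ 2 / 2 +
      Real.sqrt ((h ^ 2 / 2 - (h ^ 2 / 2) * lam1 ^ 2 - 1) ^ 2 + 4 * (h ^ 2 / 2))) / 2
    let Sig : Matrix (Fin 3) (Fin 3) ℝ := Matrix.diagonal ![s, 1, 1]
    IsUnit (C * Sig * Cᵀ) ∧
      Sig = A * Sig * Aᵀ + W - A * Sig * Cᵀ * (C * Sig * Cᵀ)⁻¹ * (C * Sig * Aᵀ) ∧
      Sig.trace = s + 2 := by
  intro A W C s Sig
  obtain ⟨hs, hroot⟩ : 0 < s ∧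
      s ^ 2 + (h ^ 2 / 2 - (h ^ 2 / 2) * lam1 ^ 2 - 1) * s - h ^ 2 / 2 = 0 := by
    have key := larger_root_pos_and_eq_zero (b := h ^ 2 / 2 - (h ^ 2 / 2) * lam1 ^ 2 - 1)
      (q := h ^ 2 / 2) (by positivity)
    have hs_eq : s = (-(h ^ 2 / 2 - (h ^ 2 / 2) * lam1 ^ 2 - 1) +
        Real.sqrt ((h ^ 2 / 2 - (h ^ 2 / 2) * lam1 ^ 2 - 1) ^ 2 + 4 * (h ^ 2 / 2))) / 2 := by
      simp only [s]
      ring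
    rwa [← hs_eq] at key
  clear_value s
  have hinnov : C * Sig * Cᵀ = !![s + h ^ 2, h; h, 2] := by
    ext i j
    fin_cases i <;> fin_cases j <;>
      simp [C, Sig, Matrix.mul_apply, Fin.sum_univ_three, Matrix.vecMul_diagonal] <;> ring
  have hdet : (!![s + h ^ 2, h; h, 2] : Matrix (Fin 2) (Fin 2) ℝ).det = 2 * s + h ^ 2 := by
    rw [Matrix.det_fin_two_of]
    ring
  have hne : 2 * s + h ^ 2 ≠ 0 := by positivity
  have hcross : A * Sig * Cᵀ = !![lam1 * s, 0; 0, 0; 0, 0] := by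
    ext i j
    fin_cases i <;> fin_cases j <;>
      simp [A, C, Sig]
  have hcross' : C * Sig * Aᵀ = !![lam1 * s, 0, 0; 0, 0, 0] := by
    ext i j
    fin_cases i <;> fin_cases j <;>
      simp [A, C, Sig, Matrix.vecMul_diagonal, mul_comm]
  refine ⟨?_, ?_, ?_⟩
  · rw [hinnov, Matrix.isUnit_iff_isUnit_det, hdet]
    exact hne.isUnit
  · rw [hinnov, hcross, hcross', Matrix.inv_def, hdet, Matrix.adjugate_fin_two_of,
      Ring.inverse_eq_inv']
    ext i j
    fin_cases i <;> fin_cases j <;>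
      simp [A, W, Sig]
    field_simp
    linear_combination 2 * hroot
  · simp [Sig, Matrix.trace, Fin.sum_univ_three]
    ring
end

section
/- Let λ₁ ∈ ℝ with 0 < λ₁ < 1. For h > 0 define σ₂₃(h) := (1 + (h²/2)λ₁² − h²/2 + √((h²/2 − (h²/2)λ₁² − 1)² + 4·(h²/2)))/2. Then (σ₂₃(h) + 2)/3 → 2/3 + 1/(3(1 − λ₁²)) as h → ∞. -/
open Filter Topology in
/-- The positive root of `σ² + (b x - 1) σ - x = 0` tends to `1 / b` as `x → ∞`. -/
theorem tendsto_riccati_root {b : ℝ} (hb : 0 < b) :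
    Tendsto (fun x : ℝ => (-(b * x - 1) + √((b * x - 1) ^ 2 + 4 * x)) / 2)
      atTop (𝓝 (1 / b)) := by
  have hcont : ContinuousAt (fun y : ℝ => 2 / ((b - y) + √((b - y) ^ 2 + 4 * y))) 0 := by
    refine ContinuousAt.div (by fun_prop) (by fun_prop) ?_
    have := Real.sqrt_nonneg ((b - 0) ^ 2 + 4 * 0)
    linarith
  have hlim := hcont.tendsto.comp (tendsto_inv_atTop_zero (𝕜 := ℝ))
  have hval : 2 / ((b - 0) + √((b - 0) ^ 2 + 4 * 0)) = 1 / b := by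
    simp only [sub_zero, mul_zero, add_zero, Real.sqrt_sq hb.le]
    field_simp
    norm_num
  rw [hval] at hlim
  refine hlim.congr' ?_
  filter_upwards [eventually_gt_atTop 0, eventually_gt_atTop (1 / b)] with x hx hxb
  have hpos : 0 < b * x - 1 := by
    rw [div_lt_iff₀ hb] at hxb
    linarith
  set t := b * x - 1 with ht
  have hsq : (b - x⁻¹) ^ 2 + 4 * x⁻¹ = (t ^ 2 + 4 * x) / x ^ 2 := by
    rw [ht]
    field_simp
  have hden : b - x⁻¹ = t / x := by
    rw [ht]
    field_simp
  have hs : √(t ^ 2 + 4 * x) ^ 2 = t ^ 2 + 4 * x := Real.sq_sqrt (by positivity)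
  rw [Function.comp_apply, hsq, hden, Real.sqrt_div' _ (sq_nonneg x), Real.sqrt_sq hx.le,
    ← add_div, div_div_eq_mul_div, div_eq_div_iff (by positivity) two_ne_zero]
  linear_combination -hs

/-- the ratio of the greedy a priori trace to the optimal trace in the
three-state selection example tends to `2/3 + 1/(3(1-λ₁²))` as `h → ∞`. -/
theorem greedy_priori_ratio_limit (lam1 : ℝ) (h1 : 0 < lam1) (h2 : lam1 < 1) :
    Filter.Tendsto
      (fun h : ℝ =>
        ((1 + (h ^ 2 / 2) * lam1 ^ 2 - h ^ 2 / 2 +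
            Real.sqrt ((h ^ 2 / 2 - (h ^ 2 / 2) * lam1 ^ 2 - 1) ^ 2 +
              4 * (h ^ 2 / 2))) / 2 + 2) / 3)
      Filter.atTop (nhds (2 / 3 + 1 / (3 * (1 - lam1 ^ 2)))) := by
  have hb : 0 < 1 - lam1 ^ 2 := by nlinarith
  have hx : Filter.Tendsto (fun h : ℝ => h ^ 2 / 2) Filter.atTop Filter.atTop :=
    (Filter.tendsto_pow_atTop two_ne_zero).atTop_div_const two_pos
  have hlim := (((tendsto_riccati_root hb).comp hx).add_const 2).div_const 3
  convert hlim using 1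
  · funext h
    simp only [Function.comp_apply]
    ring_nf
  · congr 1
    field_simp
    ring
end

section
/- Let λ₁ ∈ ℝ with 0 < λ₁ < 1. For h > 0 define σ₂₃(h) := (1 + (h²/2)λ₁² − h²/2 + √((h²/2 − (h²/2)λ₁² − 1)² + 4·(h²/2)))/2. Then 1 + h²(σ₂₃(h) − 1)/(2σ₂₃(h) + h²) → 1/(1 − λ₁²) as h → ∞. -/
open Filter Topology

/-- The positive root of `t * x ^ 2 + (a - t) * x - 1`, written without cancellation so that it is
continuous at `t = 0`. -/
noncomputable def rescaledRoot (a t : ℝ) : ℝ :=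
  2 / (√((a - t) ^ 2 + 4 * t) + (a - t))

lemma rescaledRoot_denom_pos (a : ℝ) {t : ℝ} (ht : 0 < t) :
    0 < √((a - t) ^ 2 + 4 * t) + (a - t) := by
  have h : |a - t| < √((a - t) ^ 2 + 4 * t) := by
    rw [← Real.sqrt_sq_eq_abs]
    exact Real.sqrt_lt_sqrt (sq_nonneg _) (by linarith)
  linarith [neg_abs_le (a - t)]

lemma rescaledRoot_pos (a : ℝ) {t : ℝ} (ht : 0 < t) : 0 < rescaledRoot a t :=
  div_pos two_pos (rescaledRoot_denom_pos a ht)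

lemma quadratic_root_eq_rescaledRoot (a : ℝ) {u : ℝ} (hu : 0 < u) :
    (1 - u * a + √((u * a - 1) ^ 2 + 4 * u)) / 2 = rescaledRoot a u⁻¹ := by
  have hd := rescaledRoot_denom_pos a (inv_pos.mpr hu)
  have hsqrt : √((u * a - 1) ^ 2 + 4 * u) = u * √((a - u⁻¹) ^ 2 + 4 * u⁻¹) := by
    rw [show (u * a - 1) ^ 2 + 4 * u = u ^ 2 * ((a - u⁻¹) ^ 2 + 4 * u⁻¹) by field_simp,
      Real.sqrt_mul (sq_nonneg u), Real.sqrt_sq hu.le]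
  have hsq := Real.sq_sqrt (show 0 ≤ (a - u⁻¹) ^ 2 + 4 * u⁻¹ by positivity)
  have hinv : u * u⁻¹ = 1 := mul_inv_cancel₀ hu.ne'
  rw [rescaledRoot, eq_div_iff hd.ne', hsqrt]
  generalize √((a - u⁻¹) ^ 2 + 4 * u⁻¹) = s at hsq ⊢
  generalize u⁻¹ = t at hsq hinv ⊢
  linear_combination u / 2 * hsq + (2 - (s + a - t) / 2) * hinv

lemma tendsto_rescaledRoot {a : ℝ} (ha : 0 < a) :
    Tendsto (rescaledRoot a) (𝓝 0) (𝓝 (1 / a)) := by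
  have hden : √((a - 0) ^ 2 + 4 * 0) + (a - 0) = 2 * a := by
    simp [Real.sqrt_sq ha.le, two_mul]
  have hcont : ContinuousAt (rescaledRoot a) 0 := by
    unfold rescaledRoot
    exact continuousAt_const.div (by fun_prop) (by rw [hden]; positivity)
  convert hcont.tendsto using 2
  rw [rescaledRoot, hden]
  field_simp

lemma tendsto_rescaled_trace {a : ℝ} (ha : 0 < a) :
    Tendsto (fun t => 1 + (rescaledRoot a t - 1) / (rescaledRoot a t * t + 1)) (𝓝 0)
      (𝓝 (1 / a)) := by
  have hroot := tendsto_rescaledRoot ha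
  have h := ((hroot.sub_const 1).div ((hroot.mul tendsto_id).add_const 1) (by simp)).const_add 1
  simpa using h


/-- the greedy a posteriori trace in the three-state selection example
tends to `1/(1-λ₁²)` as `h → ∞`. -/
theorem greedy_posteriori_ratio_limit (lam1 : ℝ) (h1 : 0 < lam1) (h2 : lam1 < 1) :
    Filter.Tendsto
      (fun h : ℝ =>
        1 + h ^ 2 *
            ((1 + (h ^ 2 / 2) * lam1 ^ 2 - h ^ 2 / 2 +
                Real.sqrt ((h ^ 2 / 2 - (h ^ 2 / 2) * lam1 ^ 2 - 1) ^ 2 +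
                  4 * (h ^ 2 / 2))) / 2 - 1) /
          (2 * ((1 + (h ^ 2 / 2) * lam1 ^ 2 - h ^ 2 / 2 +
                Real.sqrt ((h ^ 2 / 2 - (h ^ 2 / 2) * lam1 ^ 2 - 1) ^ 2 +
                  4 * (h ^ 2 / 2))) / 2) + h ^ 2))
      Filter.atTop (nhds (1 / (1 - lam1 ^ 2))) := by
  have ha : 0 < 1 - lam1 ^ 2 := by nlinarith
  have ht : Tendsto (fun h : ℝ => (h ^ 2 / 2)⁻¹) atTop (𝓝 0) :=
    ((tendsto_pow_atTop two_ne_zero).atTop_div_const two_pos).inv_tendsto_atTop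
  refine ((tendsto_rescaled_trace ha).comp ht).congr' ?_
  filter_upwards [eventually_gt_atTop 0] with h hh
  have hu : 0 < h ^ 2 / 2 := by positivity
  have hroot : (1 + (h ^ 2 / 2) * lam1 ^ 2 - h ^ 2 / 2 +
      Real.sqrt ((h ^ 2 / 2 - (h ^ 2 / 2) * lam1 ^ 2 - 1) ^ 2 + 4 * (h ^ 2 / 2))) / 2 =
      rescaledRoot (1 - lam1 ^ 2) (h ^ 2 / 2)⁻¹ := by
    rw [← quadratic_root_eq_rescaledRoot _ hu]
    ring_nf
  have hpos := rescaledRoot_pos (1 - lam1 ^ 2) (inv_pos.mpr hu)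
  rw [hroot, Function.comp_apply]
  generalize rescaledRoot (1 - lam1 ^ 2) (h ^ 2 / 2)⁻¹ = σ at hpos ⊢
  field_simp
end

section
/- Let λ₁ ∈ ℝ with 0 < λ₁ < 1. For h > 0 define σ(h) := (1 + h²λ₁² − h² + √((h² − h²λ₁² − 1)² + 4h²))/2. Then (1/(1 − λ₁²) + 2)/(σ(h) + 2) → 2/3 + 1/(3(1 − λ₁²)) as h → 0⁺. -/
/-- the ratio of the optimal-attack a priori trace to the greedy-attack
trace in the three-state, four-sensor example tends to `2/3 + 1/(3(1-λ₁²))` as `h → 0⁺`. -/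
theorem attack_priori_ratio_limit (lam1 : ℝ) (h1 : 0 < lam1) (h2 : lam1 < 1) :
    Filter.Tendsto
      (fun h : ℝ =>
        (1 / (1 - lam1 ^ 2) + 2) /
          ((1 + h ^ 2 * lam1 ^ 2 - h ^ 2 +
              Real.sqrt ((h ^ 2 - h ^ 2 * lam1 ^ 2 - 1) ^ 2 + 4 * h ^ 2)) / 2 + 2))
      (nhdsWithin 0 (Set.Ioi 0)) (nhds (2 / 3 + 1 / (3 * (1 - lam1 ^ 2)))) := by
  have hne : 1 - lam1 ^ 2 ≠ 0 := by nlinarith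
  have hcont : ContinuousAt
      (fun h : ℝ =>
        (1 / (1 - lam1 ^ 2) + 2) /
          ((1 + h ^ 2 * lam1 ^ 2 - h ^ 2 +
              Real.sqrt ((h ^ 2 - h ^ 2 * lam1 ^ 2 - 1) ^ 2 + 4 * h ^ 2)) / 2 + 2)) 0 := by
    refine ContinuousAt.div (by fun_prop) (by fun_prop) ?_
    norm_num
  convert hcont.tendsto.mono_left nhdsWithin_le_nhds using 2
  norm_num
  field_simp
  ring
end
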